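/- arXiv:2412.20915 — 4 statements merged into one kernel-verified Lean document; each statement's English description precedes it below -/
import Mathlib

section
/- Let W be an algebraic Weyl tensor on Euclidean ℝ⁴ in normal form with parameters λ₁,λ₂,λ₃,μ₁,μ₂,μ₃, not all zero. Then the vector T = e₁ + e₂ + e₃ + e₄ satisfies W(T,x,y,T) = 0 for all x,y ∈ ℝ⁴ if and only if λ₁ = −μ₁ − 2μ₂ and λ₂ = 2μ₁ + μ₂. -/
open scoped BigOperators

/-- Vectors in ℝ⁴. -/
abbrev V4 : Type := Fin 4 → ℝ

/-- Covariant 4-tensors (multilinear maps ℝ⁴×ℝ⁴×ℝ⁴×ℝ⁴ → ℝ). -/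
abbrev Tensor4 : Type := MultilinearMap ℝ (fun _ : Fin 4 => V4) ℝ

/-- Evaluation of a 4-tensor on four vectors. -/
def tapp (W : Tensor4) (x y z w : V4) : ℝ := W ![x, y, z, w]

/-- Standard basis of ℝ⁴ (0-indexed: `e 0 = e₁`, …, `e 3 = e₄`). -/
def e (i : Fin 4) : V4 := Pi.single i 1

/-- `W` is an algebraic Weyl tensor on Euclidean ℝ⁴: it has the symmetries of a
curvature tensor, satisfies the first Bianchi identity, and is trace-free with
respect to the Euclidean inner product. -/
def IsWeylE (W : Tensor4) : Prop :=
  (∀ x y z w, tapp W x y z w = - tapp W y x z w) ∧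
  (∀ x y z w, tapp W x y z w = - tapp W x y w z) ∧
  (∀ x y z w, tapp W x y z w = tapp W z w x y) ∧
  (∀ x y z w, tapp W x y z w + tapp W y z x w + tapp W z x y w = 0) ∧
  (∀ x y, ∑ i : Fin 4, tapp W (e i) x y (e i) = 0)

/-- The six coordinate 2-planes `e₁∧e₂, e₁∧e₃, e₁∧e₄, e₃∧e₄, e₄∧e₂, e₂∧e₃`
(0-indexed pairs). -/
def pairs : Fin 6 → Fin 4 × Fin 4 := ![(0,1), (0,2), (0,3), (2,3), (3,1), (1,2)]

/-- The normal-form matrix of the Weyl operator in the basis of coordinate 2-planes. -/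
def NFmat (l1 l2 l3 m1 m2 m3 : ℝ) : Matrix (Fin 6) (Fin 6) ℝ :=
  !![l1, 0, 0, m1, 0, 0;
     0, l2, 0, 0, m2, 0;
     0, 0, l3, 0, 0, m3;
     m1, 0, 0, l1, 0, 0;
     0, m2, 0, 0, l2, 0;
     0, 0, m3, 0, 0, l3]

/-- `W` is in normal form with parameters `λ₁,λ₂,λ₃,μ₁,μ₂,μ₃`: the traces vanish,
and the components `W(e_{pair c}, e_{pair r})` are exactly the entries of the
normal-form matrix.  (Together with the curvature symmetries this specifies all
components of `W`: those not obtained from the listed ones by symmetries are zero.) -/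
def InNormalForm (W : Tensor4) (l1 l2 l3 m1 m2 m3 : ℝ) : Prop :=
  l1 + l2 + l3 = 0 ∧ m1 + m2 + m3 = 0 ∧
  ∀ c r : Fin 6,
    tapp W (e (pairs c).1) (e (pairs c).2) (e (pairs r).1) (e (pairs r).2) =
      NFmat l1 l2 l3 m1 m2 m3 r c

/-- The Plücker coordinate of `x ∧ y` along the coordinate 2-plane `pairs p`. -/
def plucker (x y : V4) (p : Fin 6) : ℝ :=
  x (pairs p).1 * y (pairs p).2 - x (pairs p).2 * y (pairs p).1

/-- A linear functional on ℝ⁴ is determined by its values on the standard basis. -/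
lemma IsLinearMap.apply_eq_sum_e {f : V4 → ℝ} (hf : IsLinearMap ℝ f) (x : V4) :
    f x = ∑ i, x i * f (e i) := by
  have he : ∀ i, e i = fun j => if i = j then 1 else 0 := fun i => by
    funext j
    simp [e, Pi.single_apply, eq_comm]
  simpa [he] using (hf.mk' f).pi_apply_eq_sum_univ x

/-- An antisymmetric bilinear form on ℝ⁴ expressed in Plücker coordinates. -/
lemma eq_sum_plucker {f : V4 → V4 → ℝ} (hlin : ∀ y, IsLinearMap ℝ fun x => f x y)
    (hanti : ∀ x y, f x y = -f y x) (x y : V4) :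
    f x y = ∑ p, plucker x y p * f (e (pairs p).1) (e (pairs p).2) := by
  have hexp : f x y = ∑ i, x i * ∑ j, y j * -f (e j) (e i) := by
    rw [(hlin y).apply_eq_sum_e x]
    refine Finset.sum_congr rfl fun i _ => ?_
    rw [hanti, (hlin (e i)).apply_eq_sum_e y, ← Finset.sum_neg_distrib]
    simp only [mul_neg]
  have hdiag : ∀ i, f (e i) (e i) = 0 := fun i => by linarith [hanti (e i) (e i)]
  rw [hexp]
  simp only [Fin.sum_univ_four, Fin.sum_univ_six, plucker, pairs, hdiag]
  simp
  rw [hanti (e 1) (e 0), hanti (e 2) (e 0), hanti (e 3) (e 0), hanti (e 3) (e 2),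
    hanti (e 3) (e 1), hanti (e 2) (e 1)]
  ring

lemma isLinearMap_tapp_first (W : Tensor4) (y z w : V4) :
    IsLinearMap ℝ fun x => tapp W x y z w where
  map_add a b := by simpa [tapp] using W.cons_add ![y, z, w] a b
  map_smul c a := by simpa [tapp] using W.cons_smul ![y, z, w] c a

/-- A tensor with the pair symmetries is determined by its components on coordinate 2-planes. -/
lemma IsWeylE.tapp_eq_sum {W : Tensor4} (hW : IsWeylE W) (x y z w : V4) :
    tapp W x y z w = ∑ p, plucker x y p * ∑ r, plucker z w r *
      tapp W (e (pairs p).1) (e (pairs p).2) (e (pairs r).1) (e (pairs r).2) := by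
  obtain ⟨hanti, -, hswap, -, -⟩ := hW
  have hfirst := fun z w x y => eq_sum_plucker (f := fun x y => tapp W x y z w)
    (fun y => isLinearMap_tapp_first W y z w) (fun x y => hanti x y z w) x y
  rw [hfirst z w x y]
  refine Finset.sum_congr rfl fun p _ => ?_
  simp only [hswap (e (pairs p).1)]
  rw [hfirst _ _ z w]

/-- The form `W(T, ·, ·, T)` of a Weyl tensor in normal form, for `T = e₁ + e₂ + e₃ + e₄`. -/
lemma InNormalForm.tapp_sum_e {W : Tensor4} {l1 l2 l3 m1 m2 m3 : ℝ}
    (hNF : InNormalForm W l1 l2 l3 m1 m2 m3) (hW : IsWeylE W) (x y : V4) :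
    tapp W (e 0 + e 1 + e 2 + e 3) x y (e 0 + e 1 + e 2 + e 3) =
      (l1 + m2 - m3) * (x 0 * y 1 + x 1 * y 0 + x 2 * y 3 + x 3 * y 2) +
      (l2 + m3 - m1) * (x 0 * y 2 + x 2 * y 0 + x 1 * y 3 + x 3 * y 1) +
      (l3 + m1 - m2) * (x 0 * y 3 + x 3 * y 0 + x 1 * y 2 + x 2 * y 1) := by
  obtain ⟨hl, -, hcomp⟩ := hNF
  have hT : e 0 + e 1 + e 2 + e 3 = fun _ => 1 := by
    funext i
    fin_cases i <;> simp [e]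
  rw [hT, hW.tapp_eq_sum]
  simp only [hcomp]
  simp [Fin.sum_univ_six, plucker, pairs, NFmat]
  linear_combination (-(x 0 * y 0 + x 1 * y 1 + x 2 * y 2 + x 3 * y 3)) * hl

/-- Corollary `cor:examples`, first part: if the normal-form
parameters are not all zero, then `T = e₁+e₂+e₃+e₄` satisfies `W(T,·,·,T) = 0`
iff `λ₁ = −μ₁ − 2μ₂` and `λ₂ = 2μ₁ + μ₂`. -/
theorem stmt1 (W : Tensor4) (l1 l2 l3 m1 m2 m3 : ℝ)
    (hW : IsWeylE W) (hNF : InNormalForm W l1 l2 l3 m1 m2 m3)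
    (hne : ¬ (l1 = 0 ∧ l2 = 0 ∧ l3 = 0 ∧ m1 = 0 ∧ m2 = 0 ∧ m3 = 0)) :
    (∀ x y : V4,
        tapp W (e 0 + e 1 + e 2 + e 3) x y (e 0 + e 1 + e 2 + e 3) = 0) ↔
      (l1 = -m1 - 2*m2 ∧ l2 = 2*m1 + m2) := by
  obtain ⟨hl, hm, -⟩ := id hNF
  simp only [hNF.tapp_sum_e hW]
  constructor
  · intro h
    have h01 := h (e 0) (e 1)
    have h02 := h (e 0) (e 2)
    simp [e] at h01 h02
    constructor <;> linarith
  · rintro ⟨h1, h2⟩ x y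
    have hc1 : l1 + m2 - m3 = 0 := by linarith
    have hc2 : l2 + m3 - m1 = 0 := by linarith
    have hc3 : l3 + m1 - m2 = 0 := by linarith
    simp only [hc1, hc2, hc3, zero_mul, add_zero]
end

section
/- Let λ, μ ∈ ℝ, let M : ℝ⁶ → ℝ⁶ be the linear map whose matrix in the basis u₁,…,u₆ is [[−2λ,0,0,−2μ,0,0],[0,λ−1/2,0,0,μ,−1/2],[0,0,λ+1/2,0,−1/2,μ],[2μ,0,0,−2λ,0,0],[0,−μ,1/2,0,λ−1/2,0],[0,1/2,−μ,0,0,λ+1/2]] (the Petrov Type II normal form, Type N when λ = μ = 0), and let W : ℝ⁴×ℝ⁴×ℝ⁴×ℝ⁴ → ℝ be any multilinear map satisfying W(x,y,z,w) = −W(y,x,z,w) = −W(x,y,w,z) = W(z,w,x,y) and ⟨M u_c, u_r⟩_L = W(e_{i(c)}, e_{j(c)}, e_{i(r)}, e_{j(r)}) for all r,c ∈ {1,…,6}. Then there is no timelike T ∈ ℝ⁴ with W(T,x,y,T) = 0 for all x,y ∈ ℝ⁴. -/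
open scoped BigOperators

/-- ℝ⁶, identified with Λ²ℝ⁴ via the ordered basis
`e₁∧e₂, e₁∧e₃, e₁∧e₄, e₃∧e₄, e₄∧e₂, e₂∧e₃`. -/
abbrev V6 : Type := Fin 6 → ℝ

/-- Standard basis of ℝ⁶ (0-indexed: `u 0 = u₁`, …, `u 5 = u₆`). -/
def u (c : Fin 6) : V6 := Pi.single c 1

/-- The Minkowski inner product `η` on ℝ⁴ (timelike direction `e₁`). -/
def etaR4 (x y : V4) : ℝ := -(x 0 * y 0) + x 1 * y 1 + x 2 * y 2 + x 3 * y 3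

/-- The Lorentzian inner product `⟨·,·⟩_L` on ℝ⁶, of signature (−−−+++). -/
def ipL (ξ η : V6) : ℝ :=
  -(ξ 0 * η 0) - ξ 1 * η 1 - ξ 2 * η 2 + ξ 3 * η 3 + ξ 4 * η 4 + ξ 5 * η 5

/-- The matrix of the Lorentzian Hodge star `J = [[0, I₃],[−I₃, 0]]`. -/
def Jmat : Matrix (Fin 6) (Fin 6) ℝ :=
  !![0,0,0,1,0,0;
     0,0,0,0,1,0;
     0,0,0,0,0,1;
     -1,0,0,0,0,0;
     0,-1,0,0,0,0;
     0,0,-1,0,0,0]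

/-- The Lorentzian Hodge star `J` as a linear map on ℝ⁶. -/
def J : V6 →ₗ[ℝ] V6 := Matrix.toLin' Jmat

/-- The matrix of the Riemannian Hodge star `S = [[0, I₃],[I₃, 0]]`. -/
def Smat : Matrix (Fin 6) (Fin 6) ℝ :=
  !![0,0,0,1,0,0;
     0,0,0,0,1,0;
     0,0,0,0,0,1;
     1,0,0,0,0,0;
     0,1,0,0,0,0;
     0,0,1,0,0,0]

/-- The Riemannian Hodge star `S` as a linear map on ℝ⁶. -/
def S : V6 →ₗ[ℝ] V6 := Matrix.toLin' Smat

/-- `W` is an algebraic Weyl tensor on Minkowski ℝ⁴ (η-trace-free). -/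
def IsWeylM (W : Tensor4) : Prop :=
  (∀ x y z w, tapp W x y z w = - tapp W y x z w) ∧
  (∀ x y z w, tapp W x y z w = - tapp W x y w z) ∧
  (∀ x y z w, tapp W x y z w = tapp W z w x y) ∧
  (∀ x y z w, tapp W x y z w + tapp W y z x w + tapp W z x y w = 0) ∧
  (∀ x y, -(tapp W (e 0) x y (e 0)) + tapp W (e 1) x y (e 1)
      + tapp W (e 2) x y (e 2) + tapp W (e 3) x y (e 3) = 0)

/-- `WL` is the Lorentzian Weyl operator of `W`:
`⟨WL u_c, u_r⟩_L = W(e_{i(c)}, e_{j(c)}, e_{i(r)}, e_{j(r)})`. -/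
def IsLorentzWeylOp (W : Tensor4) (WL : V6 →ₗ[ℝ] V6) : Prop :=
  ∀ c r : Fin 6,
    ipL (WL (u c)) (u r) =
      tapp W (e (pairs c).1) (e (pairs c).2) (e (pairs r).1) (e (pairs r).2)

/-- `Wg` is the Riemannian Weyl operator of `W`:
`⟨Wg u_c, u_r⟩ = W(e_{i(c)}, e_{j(c)}, e_{i(r)}, e_{j(r)})` w.r.t. the dot product. -/
def IsRiemWeylOp (W : Tensor4) (Wg : V6 →ₗ[ℝ] V6) : Prop :=
  ∀ c r : Fin 6,
    (∑ i : Fin 6, Wg (u c) i * u r i) =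
      tapp W (e (pairs c).1) (e (pairs c).2) (e (pairs r).1) (e (pairs r).2)

/-- The Petrov Type II normal-form matrix (Type N when `λ = μ = 0`). -/
noncomputable def typeIImat (l m : ℝ) : Matrix (Fin 6) (Fin 6) ℝ :=
  !![-2*l, 0, 0, -2*m, 0, 0;
     0, l - 1/2, 0, 0, m, -1/2;
     0, 0, l + 1/2, 0, -1/2, m;
     2*m, 0, 0, -2*l, 0, 0;
     0, -m, 1/2, 0, l - 1/2, 0;
     0, 1/2, -m, 0, 0, l + 1/2]

/-- Expansion of `W(T, x, y, T)` in the standard coordinates of `T`. -/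
lemma tapp_eq_sum (W : Tensor4) (T x y : V4) :
    tapp W T x y T = ∑ i, ∑ j, T i * T j * tapp W (e i) x y (e j) := by
  have first : ∀ v z : V4, tapp W v x y z = ∑ i, v i * tapp W (e i) x y z := by
    intro v z
    let f : V4 →ₗ[ℝ] ℝ := W.toLinearMap ![0, x, y, z] 0
    have hf : ∀ w, f w = tapp W w x y z := fun w => by
      simp only [f, MultilinearMap.toLinearMap_apply, tapp]
      congr 1
      ext i : 1
      fin_cases i <;> simp [Function.update]
    have h := f.pi_apply_eq_sum_univ v
    simp only [hf, smul_eq_mul] at h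
    rw [h]
    refine Finset.sum_congr rfl fun i _ => ?_
    congr 2
    ext j
    simp [e, Pi.single_apply, eq_comm]
  have last : ∀ v z : V4, tapp W z x y v = ∑ j, v j * tapp W z x y (e j) := by
    intro v z
    let f : V4 →ₗ[ℝ] ℝ := W.toLinearMap ![z, x, y, 0] 3
    have hf : ∀ w, f w = tapp W z x y w := fun w => by
      simp only [f, MultilinearMap.toLinearMap_apply, tapp]
      congr 1
      ext i : 1
      fin_cases i <;> simp [Function.update]
    have h := f.pi_apply_eq_sum_univ v
    simp only [hf, smul_eq_mul] at h
    rw [h]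
    refine Finset.sum_congr rfl fun i _ => ?_
    congr 2
    ext j
    simp [e, Pi.single_apply, eq_comm]
  rw [first]
  refine Finset.sum_congr rfl fun i _ => ?_
  rw [last, Finset.mul_sum]
  exact Finset.sum_congr rfl fun j _ => by ring

/-- Type II/N case of Theorem `thm:onlyI`: if `W` is a
curvature-type tensor whose Lorentzian Weyl operator is the Petrov Type II
(or N) normal form, then there is no timelike `T` with `W(T,·,·,T) = 0`. -/
theorem stmt9 (W : Tensor4) (l m : ℝ)
    (hsym1 : ∀ x y z w, tapp W x y z w = - tapp W y x z w)
    (hsym2 : ∀ x y z w, tapp W x y z w = - tapp W x y w z)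
    (hsym3 : ∀ x y z w, tapp W x y z w = tapp W z w x y)
    (hM : ∀ c r : Fin 6,
      ipL (Matrix.toLin' (typeIImat l m) (u c)) (u r) =
        tapp W (e (pairs c).1) (e (pairs c).2) (e (pairs r).1) (e (pairs r).2)) :
    ¬ ∃ T : V4, etaR4 T T < 0 ∧ ∀ x y : V4, tapp W T x y T = 0 := by
  rintro ⟨T, hT, hW⟩
  have diag1 : ∀ x z w, tapp W x x z w = 0 := fun x z w => by linarith [hsym1 x x z w]
  have diag2 : ∀ x y z, tapp W x y z z = 0 := fun x y z => by linarith [hsym2 x y z z]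
  -- The components `W(eᵢ, e₂, e₂, eⱼ)` and `W(eᵢ, e₃, e₃, eⱼ)`, in 0-based indices.
  have w0202 := hM 1 1
  have w0212 := hM 1 5
  have w0223 := hM 1 3
  have w1212 := hM 5 5
  have w1223 := hM 5 3
  have w2323 := hM 3 3
  have w0303 := hM 2 2
  have w0331 := hM 2 4
  have w0323 := hM 2 3
  have w3131 := hM 4 4
  have w3123 := hM 4 3
  simp [ipL, u, typeIImat, pairs]
    at w0202 w0212 w0223 w1212 w1223 w2323 w0303 w0331 w0323 w3131 w3123
  have c0220 : tapp W (e 0) (e 2) (e 2) (e 0) = l - 1 / 2 := by rw [hsym2]; linarith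
  have c0221 : tapp W (e 0) (e 2) (e 2) (e 1) = -1 / 2 := by rw [hsym2]; linarith
  have c1220 : tapp W (e 1) (e 2) (e 2) (e 0) = -1 / 2 := by rw [hsym2, hsym3]; linarith
  have c1221 : tapp W (e 1) (e 2) (e 2) (e 1) = -l - 1 / 2 := by rw [hsym2]; linarith
  have c3220 : tapp W (e 3) (e 2) (e 2) (e 0) = 0 := by
    rw [hsym1, hsym2, hsym3]; linarith
  have c3221 : tapp W (e 3) (e 2) (e 2) (e 1) = 0 := by
    rw [hsym1, hsym2, hsym3]; linarith
  have c3223 : tapp W (e 3) (e 2) (e 2) (e 3) = 2 * l := by rw [hsym1]; linarith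
  have c0330 : tapp W (e 0) (e 3) (e 3) (e 0) = l + 1 / 2 := by rw [hsym2]; linarith
  have c0332 : tapp W (e 0) (e 3) (e 3) (e 2) = 0 := by rw [hsym2]; linarith
  have c1330 : tapp W (e 1) (e 3) (e 3) (e 0) = 1 / 2 := by
    rw [hsym1, hsym2, hsym3]; linarith
  have c1331 : tapp W (e 1) (e 3) (e 3) (e 1) = 1 / 2 - l := by rw [hsym1]; linarith
  have c1332 : tapp W (e 1) (e 3) (e 3) (e 2) = 0 := by rw [hsym1, hsym2]; linarith
  have c2330 : tapp W (e 2) (e 3) (e 3) (e 0) = 0 := by rw [hsym2, hsym3]; linarith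
  have c2331 : tapp W (e 2) (e 3) (e 3) (e 1) = 0 := by rw [hsym3]; linarith
  have c2332 : tapp W (e 2) (e 3) (e 3) (e 2) = 2 * l := by rw [hsym2]; linarith
  have h22 := hW (e 2) (e 2)
  have h33 := hW (e 3) (e 3)
  rw [tapp_eq_sum] at h22 h33
  simp only [Fin.sum_univ_four, diag1, diag2, c0220, c0221, ← w0223, c1220, c1221, ← w1223,
    c3220, c3221, c3223] at h22
  simp only [Fin.sum_univ_four, diag1, diag2, c0330, ← w0331, c0332, c1330, c1331, c1332,
    c2330, c2331, c2332] at h33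
  simp only [etaR4] at hT
  have hl : l = 0 := by
    have h : l * (T 0 ^ 2 - T 1 ^ 2 + T 2 ^ 2 + T 3 ^ 2) = 0 := by linarith
    refine (mul_eq_zero.mp h).resolve_right (ne_of_gt ?_)
    linarith [sq_nonneg (T 2), sq_nonneg (T 3)]
  subst hl
  have h01 : T 0 + T 1 = 0 := pow_eq_zero_iff two_ne_zero |>.mp (by linarith)
  have h0 : T 0 = -T 1 := by linarith
  rw [h0] at hT
  linarith [sq_nonneg (T 2), sq_nonneg (T 3)]
end

section
/- Let W be an algebraic Weyl tensor on Minkowski ℝ⁴, not identically zero, and suppose there exists a timelike T ∈ ℝ⁴ with W(T,x,y,T) = 0 for all x,y ∈ ℝ⁴. Then Ŵ_L commutes with J, and the induced complex-linear operator 𝒲 on the complex vector space (ℝ⁶, i := J) is diagonalizable (there is a complex basis of eigenvectors) and has exactly two or three distinct complex eigenvalues. (Equivalently: the Weyl tensor has Petrov Type I or D, and cannot have Petrov Types II, N, or III.) -/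
open scoped BigOperators

/-- `ξ` is an eigenvector of the complex-linear operator `𝒲` induced by `WL` on
`(ℝ⁶, i := J)`, with complex eigenvalue `a + bi`. -/
def IsCEigen (WL : V6 →ₗ[ℝ] V6) (a b : ℝ) (ξ : V6) : Prop :=
  ξ ≠ 0 ∧ WL ξ = a • ξ + b • J ξ

/-- The set of complex eigenvalues of `𝒲`, recorded as pairs `(a, b) ∈ ℝ × ℝ`
standing for `a + bi`. -/
def cSpectrum (WL : V6 →ₗ[ℝ] V6) : Set (ℝ × ℝ) :=
  {z | ∃ ξ : V6, IsCEigen WL z.1 z.2 ξ}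

/-- `𝒲` is diagonalizable: there is a complex basis `ξ₁, ξ₂, ξ₃` of `(ℝ⁶, i := J)`
consisting of eigenvectors, i.e. `ξ₁, Jξ₁, ξ₂, Jξ₂, ξ₃, Jξ₃` is a real basis of ℝ⁶. -/
def HasEigenBasis (WL : V6 →ₗ[ℝ] V6) : Prop :=
  ∃ (a b : Fin 3 → ℝ) (ξ : Fin 3 → V6),
    (∀ i, IsCEigen WL (a i) (b i) (ξ i)) ∧
    LinearIndependent ℝ ![ξ 0, J (ξ 0), ξ 1, J (ξ 1), ξ 2, J (ξ 2)] ∧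
    Submodule.span ℝ (Set.range ![ξ 0, J (ξ 0), ξ 1, J (ξ 1), ξ 2, J (ξ 2)]) = ⊤

/-- The bivector `x ∧ y` in the coordinates of `V6`. -/
def wedge (x y : V4) : V6 :=
  fun c => x (pairs c).1 * y (pairs c).2 - x (pairs c).2 * y (pairs c).1

lemma J_apply (ξ : V6) : J ξ = ![ξ 3, ξ 4, ξ 5, -ξ 0, -ξ 1, -ξ 2] := by
  ext i
  fin_cases i <;> simp [J, Jmat, Matrix.mulVec, dotProduct, Fin.sum_univ_six]

lemma J_J (ξ : V6) : J (J ξ) = -ξ := by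
  ext i
  fin_cases i <;> simp [J_apply]

lemma ipL_J_left (ξ η : V6) : ipL (J ξ) η = ipL ξ (J η) := by
  simp only [ipL, J_apply]
  simp
  ring

/-- `ipL` as a bilinear form. -/
def ipLForm : V6 →ₗ[ℝ] V6 →ₗ[ℝ] ℝ :=
  LinearMap.mk₂ ℝ ipL (by intros; simp [ipL]; ring) (by intros; simp [ipL]; ring)
    (by intros; simp [ipL]; ring) (by intros; simp [ipL]; ring)

lemma ipLForm_apply (ξ η : V6) : ipLForm ξ η = ipL ξ η := rfl

lemma eq_sum_u (ξ : V6) : ξ = ∑ c, ξ c • u c := by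
  simpa [u] using (pi_eq_sum_univ' ξ)

lemma eq_sum_e (x : V4) : x = ∑ i, x i • e i := by
  simpa [e] using (pi_eq_sum_univ' x)

lemma ipL_u_right (ξ : V6) (r : Fin 6) : ipL ξ (u r) = ![-1, -1, -1, 1, 1, 1] r * ξ r := by
  fin_cases r <;> simp [ipL, u]

lemma ipL_right_ext {ξ η : V6} (h : ∀ r, ipL ξ (u r) = ipL η (u r)) : ξ = η := by
  ext r
  have := h r
  fin_cases r <;> simpa [ipL_u_right] using this

lemma ipL_map_eq_sum (WL : V6 →ₗ[ℝ] V6) (ξ η : V6) :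
    ipL (WL ξ) η = ∑ c, ξ c * ∑ r, η r * ipL (WL (u c)) (u r) := by
  conv_lhs => rw [eq_sum_u ξ, eq_sum_u η, ← ipLForm_apply]
  simp only [map_sum, map_smul, LinearMap.sum_apply, LinearMap.smul_apply, smul_eq_mul,
    ipLForm_apply, Finset.mul_sum]
  rw [Finset.sum_comm]
  refine Finset.sum_congr rfl fun c _ => Finset.sum_congr rfl fun r _ => ?_
  ring

/-- An alternating bilinear function on `V4` factors through the wedge product. -/
lemma eq_sum_wedge (f : V4 → V4 → ℝ) (hadd : ∀ x x' y, f (x + x') y = f x y + f x' y)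
    (hsmul : ∀ (a : ℝ) x y, f (a • x) y = a * f x y) (hanti : ∀ x y, f x y = -f y x) (x y : V4) :
    f x y = ∑ c, wedge x y c * f (e (pairs c).1) (e (pairs c).2) := by
  have hadd' : ∀ x y y', f x (y + y') = f x y + f x y' := fun x y y' => by
    rw [hanti, hadd, hanti y, hanti y']; ring
  have hsmul' : ∀ (a : ℝ) x y, f x (a • y) = a * f x y := fun a x y => by
    rw [hanti, hsmul, hanti y]; ring
  have hself : ∀ x, f x x = 0 := fun x => by linarith [hanti x x]
  conv_lhs => rw [eq_sum_e x, eq_sum_e y]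
  simp only [Fin.sum_univ_four, hadd, hadd', hsmul, hsmul', hself, Fin.sum_univ_six, wedge, pairs]
  simp
  rw [hanti (e 1) (e 0), hanti (e 2) (e 0), hanti (e 3) (e 0), hanti (e 2) (e 1),
    hanti (e 1) (e 3), hanti (e 3) (e 2)]
  ring

section WeylOperator

variable {W : Tensor4} {WL : V6 →ₗ[ℝ] V6}

lemma tapp_add_left (W : Tensor4) (x x' y z w : V4) :
    tapp W (x + x') y z w = tapp W x y z w + tapp W x' y z w :=
  W.cons_add ![y, z, w] x x'

lemma tapp_smul_left (W : Tensor4) (a : ℝ) (x y z w : V4) :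
    tapp W (a • x) y z w = a * tapp W x y z w :=
  W.cons_smul ![y, z, w] a x

lemma tapp_eq_ipL (hW : IsWeylM W) (hWL : IsLorentzWeylOp W WL) (x y z w : V4) :
    tapp W x y z w = ipL (WL (wedge x y)) (wedge z w) := by
  obtain ⟨h12, h34, hpair, -, -⟩ := hW
  rw [ipL_map_eq_sum, eq_sum_wedge (fun x y => tapp W x y z w)
    (fun x x' y => tapp_add_left W x x' y z w) (fun a x y => tapp_smul_left W a x y z w)
    (fun x y => h12 x y z w)]
  refine Finset.sum_congr rfl fun c _ => ?_
  congr 1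
  rw [eq_sum_wedge (fun z w => tapp W (e (pairs c).1) (e (pairs c).2) z w)
    (fun z z' w => by rw [hpair, tapp_add_left, hpair, hpair z']) (fun a z w => by
      rw [hpair, tapp_smul_left, hpair]) (fun z w => h34 _ _ z w)]
  simp only [hWL c]

lemma ipL_weylOp_symm (hW : IsWeylM W) (hWL : IsLorentzWeylOp W WL) (ξ η : V6) :
    ipL (WL ξ) η = ipL ξ (WL η) := by
  have hcomm : ipL ξ (WL η) = ipL (WL η) ξ := by simp only [ipL]; ring
  rw [hcomm, ipL_map_eq_sum, ipL_map_eq_sum]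
  simp only [Finset.mul_sum]
  rw [Finset.sum_comm]
  refine Finset.sum_congr rfl fun c _ => Finset.sum_congr rfl fun r _ => ?_
  rw [hWL, hWL, hW.2.2.1]
  ring


lemma wedge_e (i j : Fin 4) : wedge (e i) (e j) =
    (!![0, u 0, u 1, u 2; -u 0, 0, u 5, -u 4; -u 1, -u 5, 0, u 3; -u 2, u 4, -u 3, 0] :
      Matrix (Fin 4) (Fin 4) V6) i j := by
  ext c
  fin_cases i <;> fin_cases j <;> fin_cases c <;> simp [wedge, pairs, e, u]

lemma J_u (c : Fin 6) : J (u c) = ![-u 3, -u 4, -u 5, u 0, u 1, u 2] c := by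
  rw [J_apply]
  ext i
  fin_cases c <;> fin_cases i <;> simp [u]

lemma ipL_neg_left (ξ η : V6) : ipL (-ξ) η = -ipL ξ η := by
  simp [← ipLForm_apply]

lemma ipL_neg_right (ξ η : V6) : ipL ξ (-η) = -ipL ξ η := by
  simp [← ipLForm_apply]

lemma ipL_zero_left (η : V6) : ipL 0 η = 0 := by
  simp [← ipLForm_apply]

lemma ipL_zero_right (ξ : V6) : ipL ξ 0 = 0 := by
  simp [← ipLForm_apply]

lemma ipL_comm (ξ η : V6) : ipL ξ η = ipL η ξ := by
  simp only [ipL]; ring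

lemma ipL_weylOp_J_u (hW : IsWeylM W) (hWL : IsLorentzWeylOp W WL) (c r : Fin 6) :
    ipL (WL (J (u c))) (u r) = ipL (WL (u c)) (J (u r)) := by
  have hsymm : ∀ c r, ipL (WL (u c)) (u r) = ipL (WL (u r)) (u c) := fun c r => by
    rw [ipL_weylOp_symm hW hWL, ipL_comm]
  have htr := fun i j => hW.2.2.2.2 (e i) (e j)
  simp only [tapp_eq_ipL hW hWL, wedge_e] at htr
  have h00 := htr 0 0
  have h01 := htr 0 1
  have h02 := htr 0 2
  have h03 := htr 0 3
  have h11 := htr 1 1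
  have h12 := htr 1 2
  have h13 := htr 1 3
  have h22 := htr 2 2
  have h23 := htr 2 3
  have h33 := htr 3 3
  clear htr
  simp [ipL_neg_left, ipL_neg_right, ipL_zero_left, ipL_zero_right]
    at h00 h01 h02 h03 h11 h12 h13 h22 h23 h33
  fin_cases c <;> fin_cases r <;> simp [J_u, ipL_neg_left, ipL_neg_right] <;>
    grind

lemma weylOp_J (hW : IsWeylM W) (hWL : IsLorentzWeylOp W WL) (ξ : V6) :
    WL (J ξ) = J (WL ξ) := by
  have key : WL ∘ₗ J = J ∘ₗ WL := by
    refine (Pi.basisFun ℝ (Fin 6)).ext fun c => ipL_right_ext fun r => ?_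
    simpa [u, ipL_J_left] using ipL_weylOp_J_u hW hWL c r
  exact LinearMap.congr_fun key ξ

lemma trace_J_comp_weylOp (hW : IsWeylM W) (hWL : IsLorentzWeylOp W WL) :
    LinearMap.trace ℝ V6 (J ∘ₗ WL) = 0 := by
  have hsymm : ∀ c r, ipL (WL (u c)) (u r) = ipL (WL (u r)) (u c) := fun c r => by
    rw [ipL_weylOp_symm hW hWL, ipL_comm]
  have hB := hW.2.2.2.1 (e 0) (e 1) (e 2) (e 3)
  simp only [tapp_eq_ipL hW hWL, wedge_e] at hB
  simp [ipL_neg_left, ipL_neg_right] at hB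
  have h03 := hsymm 0 3
  have h14 := hsymm 1 4
  have h25 := hsymm 2 5
  simp [ipL_u_right] at hB h03 h14 h25
  rw [LinearMap.trace_eq_matrix_trace ℝ (Pi.basisFun ℝ (Fin 6)), Matrix.trace]
  have hu : ∀ c : Fin 6, (Pi.single c 1 : V6) = u c := fun _ => rfl
  simp [Fin.sum_univ_six, J_apply, hu]
  linarith

lemma weylOp_ne_zero (hW : IsWeylM W) (hWL : IsLorentzWeylOp W WL) (hne : W ≠ 0) : WL ≠ 0 := by
  rintro rfl
  refine hne (MultilinearMap.ext fun v => ?_)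
  have hv : v = ![v 0, v 1, v 2, v 3] := by
    ext i
    fin_cases i <;> rfl
  rw [hv]
  simpa [ipL_zero_left, tapp] using tapp_eq_ipL hW hWL (v 0) (v 1) (v 2) (v 3)

end WeylOperator

/-- A linear map that is self-adjoint for a positive definite symmetric bilinear form has a basis
of eigenvectors. -/
lemma exists_eigenbasis_of_posDef {V : Type*} [AddCommGroup V] [Module ℝ V]
    [FiniteDimensional ℝ V] {n : ℕ} (hn : Module.finrank ℝ V = n) (B : V →ₗ[ℝ] V →ₗ[ℝ] ℝ)
    (hsymm : ∀ x y, B x y = B y x) (hpos : ∀ x, x ≠ 0 → 0 < B x x) (A : V →ₗ[ℝ] V)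
    (hA : ∀ x y, B (A x) y = B x (A y)) :
    ∃ (v : Module.Basis (Fin n) ℝ V) (l : Fin n → ℝ), ∀ i, A (v i) = l i • v i := by
  have hnonneg : ∀ x, 0 ≤ B x x := fun x => by
    rcases eq_or_ne x 0 with rfl | hx
    · simp
    · exact (hpos x hx).le
  let core : InnerProductSpace.Core ℝ V :=
    { inner := fun x y => B x y
      conj_inner_symm := fun x y => by simpa using hsymm y x
      re_inner_nonneg := fun x => by simpa using hnonneg x
      add_left := fun x y z => by simp
      smul_left := fun x y r => by simp
      definite := fun x hx => by
        by_contra h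
        exact (hpos x h).ne' hx }
  let _ : NormedAddCommGroup V := core.toNormedAddCommGroup
  let _ : InnerProductSpace ℝ V := InnerProductSpace.ofCore core.toCore
  have hAs : A.IsSymmetric := hA
  exact ⟨(hAs.eigenvectorBasis hn).toBasis, hAs.eigenvalues hn, fun i => by simp⟩

/-- The bivector `T ∧ x` for a spatial vector `x`, linearly in `x`. -/
def wedgeSpatial (T : V4) : (Fin 3 → ℝ) →ₗ[ℝ] V6 where
  toFun x := wedge T ![0, x 0, x 1, x 2]
  map_add' x y := by
    ext c
    fin_cases c <;> simp [wedge, pairs] <;> ring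
  map_smul' a x := by
    ext c
    fin_cases c <;> simp [wedge, pairs] <;> ring

lemma wedgeSpatial_apply (T : V4) (x : Fin 3 → ℝ) : wedgeSpatial T x =
    ![T 0 * x 0, T 0 * x 1, T 0 * x 2,
      T 2 * x 2 - T 3 * x 1, T 3 * x 0 - T 1 * x 2, T 1 * x 1 - T 2 * x 0] := by
  ext c
  fin_cases c <;> simp [wedgeSpatial, wedge, pairs]

lemma ipL_wedgeSpatial_J (T : V4) (x y : Fin 3 → ℝ) :
    ipL (wedgeSpatial T x) (J (wedgeSpatial T y)) = 0 := by
  simp only [wedgeSpatial_apply, J_apply, ipL]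
  simp
  ring

lemma ipL_wedgeSpatial_neg {T : V4} (hT : etaR4 T T < 0) {x : Fin 3 → ℝ} (hx : x ≠ 0) :
    ipL (wedgeSpatial T x) (wedgeSpatial T x) < 0 := by
  have hpos : 0 < x 0 ^ 2 + x 1 ^ 2 + x 2 ^ 2 := by
    obtain ⟨i, hi⟩ := Function.ne_iff.mp hx
    have := sq_pos_of_ne_zero hi
    have h0 := sq_nonneg (x 0)
    have h1 := sq_nonneg (x 1)
    have h2 := sq_nonneg (x 2)
    fin_cases i <;> simp at this <;> nlinarith
  have key : ipL (wedgeSpatial T x) (wedgeSpatial T x) =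
      etaR4 T T * (x 0 ^ 2 + x 1 ^ 2 + x 2 ^ 2) - (T 1 * x 0 + T 2 * x 1 + T 3 * x 2) ^ 2 := by
    simp only [wedgeSpatial_apply, ipL, etaR4]
    simp
    ring
  rw [key]
  nlinarith [mul_neg_of_neg_of_pos hT hpos, sq_nonneg (T 1 * x 0 + T 2 * x 1 + T 3 * x 2)]

lemma time_ne_zero {T : V4} (hT : etaR4 T T < 0) : T 0 ≠ 0 := by
  intro h
  simp only [etaR4, h] at hT
  nlinarith [mul_self_nonneg (T 1), mul_self_nonneg (T 2), mul_self_nonneg (T 3)]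

/-- The orthogonal complement of `T ∧ ℝ⁴` is its image under `J`. -/
lemma wedgeSpatial_eq_J_of_orthogonal {T : V4} (hT0 : T 0 ≠ 0) {ζ : V6}
    (h : ∀ y, ipL ζ (wedgeSpatial T y) = 0) :
    wedgeSpatial T ((T 0)⁻¹ • ![ζ 3, ζ 4, ζ 5]) = J ζ := by
  have h0 := h ![1, 0, 0]
  have h1 := h ![0, 1, 0]
  have h2 := h ![0, 0, 1]
  simp only [wedgeSpatial_apply, ipL] at h0 h1 h2
  simp at h0 h1 h2
  rw [wedgeSpatial_apply, J_apply]
  ext c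
  fin_cases c <;> simp <;> field_simp <;> linarith

/-- In the complex space `(ℝ⁶, i := J)`, the vectors `ξ i` and `J (ξ i)` are linearly independent over `ℝ`
when the `ξ i` form a basis of `T ∧ ℝ⁴`. -/
lemma linearIndependent_wedgeSpatial {T : V4} (hT : etaR4 T T < 0)
    (v : Module.Basis (Fin 3) ℝ (Fin 3 → ℝ)) :
    LinearIndependent ℝ ![wedgeSpatial T (v 0), J (wedgeSpatial T (v 0)),
      wedgeSpatial T (v 1), J (wedgeSpatial T (v 1)),
      wedgeSpatial T (v 2), J (wedgeSpatial T (v 2))] := by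
  rw [Fintype.linearIndependent_iff]
  intro g hg
  simp [Fin.sum_univ_six] at hg
  set p := g 0 • v 0 + g 2 • v 1 + g 4 • v 2 with hp
  set q := g 1 • v 0 + g 3 • v 1 + g 5 • v 2 with hq
  have hpq : wedgeSpatial T p + J (wedgeSpatial T q) = 0 := by
    rw [← hg, hp, hq]
    simp only [map_add, map_smul]
    abel
  have hzero : ∀ x y, wedgeSpatial T x + J (wedgeSpatial T y) = 0 → x = 0 := by
    intro x y hxy
    by_contra hx
    have h1 := ipL_wedgeSpatial_neg hT hx
    have h2 : ipL (wedgeSpatial T x) (wedgeSpatial T x + J (wedgeSpatial T y)) = 0 := by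
      rw [hxy, ipL_zero_right]
    rw [← ipLForm_apply, map_add, ipLForm_apply, ipLForm_apply, ipL_wedgeSpatial_J] at h2
    linarith
  have hp0 := hzero p q hpq
  have hq0 : q = 0 := by
    refine hzero q (-p) ?_
    have := congrArg J hpq
    rw [map_add, J_J, map_zero] at this
    rw [map_neg, map_neg, ← neg_eq_zero, ← this]
    abel
  have hind := Fintype.linearIndependent_iff.mp v.linearIndependent
  have hpg := hind ![g 0, g 2, g 4] (by simpa [Fin.sum_univ_three] using hp.symm.trans hp0)
  have hqg := hind ![g 1, g 3, g 5] (by simpa [Fin.sum_univ_three] using hq.symm.trans hq0)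
  intro i
  fin_cases i
  · exact hpg 0
  · exact hqg 0
  · exact hpg 1
  · exact hqg 1
  · exact hpg 2
  · exact hqg 2

/-- The eigenvalues of an operator that is diagonal in the complex basis `ξ`. -/
lemma cSpectrum_eq_range {WL : V6 →ₗ[ℝ] V6} (hJ : ∀ ξ, WL (J ξ) = J (WL ξ)) {ξ : Fin 3 → V6}
    {l : Fin 3 → ℝ} (hξ : ∀ i, WL (ξ i) = l i • J (ξ i))
    (hli : LinearIndependent ℝ ![ξ 0, J (ξ 0), ξ 1, J (ξ 1), ξ 2, J (ξ 2)])
    (hspan : Submodule.span ℝ (Set.range ![ξ 0, J (ξ 0), ξ 1, J (ξ 1), ξ 2, J (ξ 2)]) = ⊤) :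
    cSpectrum WL = Set.range fun i => ((0 : ℝ), l i) := by
  have hne : ∀ i, ξ i ≠ 0 := by
    intro i
    fin_cases i
    · exact hli.ne_zero 0
    · exact hli.ne_zero 2
    · exact hli.ne_zero 4
  ext ⟨a, b⟩
  constructor
  · rintro ⟨η, hη, h⟩
    simp only at h
    obtain ⟨g, rfl⟩ : ∃ g : Fin 6 → ℝ,
        ∑ i, g i • ![ξ 0, J (ξ 0), ξ 1, J (ξ 1), ξ 2, J (ξ 2)] i = η := by
      rw [← Submodule.mem_span_range_iff_exists_fun, hspan]
      trivial
    have hind := Fintype.linearIndependent_iff.mp hli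
      ![a * g 0 - (b - l 0) * g 1, a * g 1 + (b - l 0) * g 0,
        a * g 2 - (b - l 1) * g 3, a * g 3 + (b - l 1) * g 2,
        a * g 4 - (b - l 2) * g 5, a * g 5 + (b - l 2) * g 4] (by
      simp [Fin.sum_univ_six, hJ, hξ, J_J] at h ⊢
      rw [← sub_eq_zero] at h
      rw [← neg_eq_zero, ← h]
      module)
    have hcoef : ∀ x y m : ℝ, (0, m) ≠ (a, b) → a * x - (b - m) * y = 0 →
        a * y + (b - m) * x = 0 → x = 0 ∧ y = 0 := by
      intro x y m hm h1 h2
      have hd : a ^ 2 + (b - m) ^ 2 ≠ 0 := by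
        intro h0
        refine hm (Prod.ext ?_ ?_) <;> simp <;> nlinarith [sq_nonneg a, sq_nonneg (b - m)]
      constructor
      · refine (mul_eq_zero.mp ?_).resolve_left hd
        linear_combination a * h1 + (b - m) * h2
      · refine (mul_eq_zero.mp ?_).resolve_left hd
        linear_combination a * h2 - (b - m) * h1
    by_contra hnot
    simp only [Set.mem_range, not_exists] at hnot
    obtain ⟨h0, h1⟩ := hcoef _ _ _ (hnot 0) (hind 0) (hind 1)
    obtain ⟨h2, h3⟩ := hcoef _ _ _ (hnot 1) (hind 2) (hind 3)
    obtain ⟨h4, h5⟩ := hcoef _ _ _ (hnot 2) (hind 4) (hind 5)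
    exact hη (by simp [Fin.sum_univ_six, h0, h1, h2, h3, h4, h5])
  · rintro ⟨i, hi⟩
    obtain ⟨rfl, rfl⟩ := Prod.ext_iff.mp hi
    exact ⟨ξ i, hne i, by simp [hξ]⟩

lemma ncard_range_two_or_three {l : Fin 3 → ℝ} (hsum : l 0 + l 1 + l 2 = 0)
    (hne : ¬(l 0 = 0 ∧ l 1 = 0 ∧ l 2 = 0)) :
    (Set.range fun i => ((0 : ℝ), l i)).ncard = 2 ∨
      (Set.range fun i => ((0 : ℝ), l i)).ncard = 3 := by
  have hle : (Set.range fun i => ((0 : ℝ), l i)).ncard ≤ 3 := by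
    rw [← Set.image_univ]
    refine (Set.ncard_image_le Set.finite_univ).trans ?_
    simp [Set.ncard_univ]
  have hlt : 1 < (Set.range fun i => ((0 : ℝ), l i)).ncard := by
    rw [Set.one_lt_ncard (Set.finite_range _)]
    by_cases h : l 0 = l 1
    · refine ⟨_, ⟨0, rfl⟩, _, ⟨2, rfl⟩, fun h' => hne ?_⟩
      have h2 : l 0 = l 2 := congrArg Prod.snd h'
      refine ⟨?_, ?_, ?_⟩ <;> linarith
    · exact ⟨_, ⟨0, rfl⟩, _, ⟨1, rfl⟩, fun h' => h (congrArg Prod.snd h')⟩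
  omega

/-- On `T ∧ ℝ⁴`, the operator `J ∘ Ŵ_L` is self-adjoint for the definite form `-⟨·,·⟩_L`, so it
has an eigenbasis there. -/
lemma exists_basis_weylOp_wedgeSpatial {W : Tensor4} {WL : V6 →ₗ[ℝ] V6} (hW : IsWeylM W)
    (hWL : IsLorentzWeylOp W WL) {T : V4} (hT : etaR4 T T < 0)
    (hWT : ∀ x y : V4, tapp W T x y T = 0) :
    ∃ (v : Module.Basis (Fin 3) ℝ (Fin 3 → ℝ)) (l : Fin 3 → ℝ),
      ∀ i, WL (wedgeSpatial T (v i)) = l i • J (wedgeSpatial T (v i)) := by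
  have horth : ∀ x y, ipL (WL (wedgeSpatial T x)) (wedgeSpatial T y) = 0 := fun x y => by
    have h := tapp_eq_ipL hW hWL T ![0, x 0, x 1, x 2] T ![0, y 0, y 1, y 2]
    rw [hW.2.1, hWT, neg_zero] at h
    exact h.symm
  let A : (Fin 3 → ℝ) →ₗ[ℝ] (Fin 3 → ℝ) :=
    (T 0)⁻¹ • LinearMap.funLeft ℝ ℝ ![3, 4, 5] ∘ₗ WL ∘ₗ wedgeSpatial T
  have hA : ∀ x, wedgeSpatial T (A x) = J (WL (wedgeSpatial T x)) := fun x => by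
    rw [← wedgeSpatial_eq_J_of_orthogonal (time_ne_zero hT) (horth x)]
    congr 1
    ext i
    fin_cases i <;> simp [A, LinearMap.funLeft]
  obtain ⟨v, l, hv⟩ := exists_eigenbasis_of_posDef (Module.finrank_fin_fun ℝ (n := 3))
    (-(ipLForm.compl₁₂ (wedgeSpatial T) (wedgeSpatial T)))
    (fun x y => by simp [ipLForm_apply, ipL_comm])
    (fun x hx => by simpa [ipLForm_apply] using ipL_wedgeSpatial_neg hT hx) A
    (fun x y => by
      simp [ipLForm_apply, hA]
      rw [ipL_J_left, ipL_weylOp_symm hW hWL, weylOp_J hW hWL])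
  refine ⟨v, -l, fun i => ?_⟩
  have h := congrArg J (hA (v i))
  rw [J_J, hv, map_smul, map_smul] at h
  rw [Pi.neg_apply, neg_smul, h, neg_neg]

/-- Theorem `prop:N` + Petrov classification: if a nonzero
algebraic Weyl tensor on Minkowski ℝ⁴ satisfies `W(T,·,·,T) = 0` for some
timelike `T`, then `Ŵ_L` commutes with `J`, the induced complex operator `𝒲` is
diagonalizable, and it has exactly two or three distinct complex eigenvalues
(Petrov Type I or D; Types II, N, III cannot occur). -/
theorem stmt10 (W : Tensor4) (WL : V6 →ₗ[ℝ] V6)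
    (hW : IsWeylM W) (hne : W ≠ 0) (hWL : IsLorentzWeylOp W WL)
    (hT : ∃ T : V4, etaR4 T T < 0 ∧ ∀ x y : V4, tapp W T x y T = 0) :
    WL.comp J = J.comp WL ∧ HasEigenBasis WL ∧
      ((cSpectrum WL).ncard = 2 ∨ (cSpectrum WL).ncard = 3) := by
  obtain ⟨T, hT, hWT⟩ := hT
  have hJ := weylOp_J hW hWL
  obtain ⟨v, l, hv⟩ := exists_basis_weylOp_wedgeSpatial hW hWL hT hWT
  have hli := linearIndependent_wedgeSpatial hT v
  have hspan := hli.span_eq_top_of_card_eq_finrank' (by simp)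
  refine ⟨LinearMap.ext hJ, ⟨0, l, fun i => wedgeSpatial T (v i), fun i => ⟨fun h => ?_, ?_⟩,
    hli, hspan⟩, ?_⟩
  · have := ipL_wedgeSpatial_neg hT (v.ne_zero i)
    simp only at h
    rw [h, ipL_zero_left] at this
    exact this.false
  · simpa using hv i
  rw [cSpectrum_eq_range hJ (ξ := fun i => wedgeSpatial T (v i)) hv hli hspan]
  let b := Module.Basis.mk hli hspan.ge
  refine ncard_range_two_or_three ?_ fun h0 => weylOp_ne_zero hW hWL hne (b.ext fun i => ?_)
  · have htr := trace_J_comp_weylOp hW hWL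
    have hdiag : ∀ i, (J ∘ₗ WL) (b i) = (-![l 0, l 0, l 1, l 1, l 2, l 2] i) • b i := by
      intro i
      fin_cases i <;> simp [b, hJ, hv, J_J]
    rw [LinearMap.trace_eq_matrix_trace ℝ b, Matrix.trace] at htr
    simp only [Matrix.diag_apply, LinearMap.toMatrix_apply, hdiag, map_smul, Finsupp.smul_apply,
      Module.Basis.repr_self, Finsupp.single_eq_same, Fin.sum_univ_six] at htr
    simp at htr
    linarith
  · fin_cases i <;> simp [b, hJ, hv, h0]
end

section
/- Let M be a complex 3×3 matrix with Mᵀ = M such that the span of all eigenvectors of M (the sum of all eigenspaces) is 2-dimensional. Then there exist eigenvectors ζ₁, ζ₂ of M with b(ζ₁,ζ₁) = 0, b(ζ₂,ζ₂) = 1, and b(ζ₁,ζ₂) = 0. -/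
open Matrix

/-- Vectors in ℂ³. -/
abbrev C3 : Type := Fin 3 → ℂ

/-- The symmetric bilinear form `b(z,w) = z₁w₁ + z₂w₂ + z₃w₃` on ℂ³. -/
def b (z w : C3) : ℂ := z 0 * w 0 + z 1 * w 1 + z 2 * w 2

/-- The span of all eigenvectors of `M` (the sum of all eigenspaces). -/
noncomputable def eigSpan (M : Matrix (Fin 3) (Fin 3) ℂ) : Submodule ℂ C3 :=
  Submodule.span ℂ {z : C3 | z ≠ 0 ∧ ∃ μ : ℂ, M.mulVec z = μ • z}

theorem b_eq_dotProduct (z w : C3) : b z w = z ⬝ᵥ w := by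
  simp [b, dotProduct, Fin.sum_univ_three]

/-- A vector whose cross product with a nonzero vector vanishes is a multiple of it. -/
theorem exists_eq_smul_of_cross_eq_zero {n w : C3} (hn : n ≠ 0) (h : n ⨯₃ w = 0) :
    ∃ c : ℂ, w = c • n := by
  have hdep : ¬ LinearIndependent ℂ ![n, w] := fun hli =>
    crossProduct_ne_zero_iff_linearIndependent.mpr hli h
  rw [LinearIndependent.pair_iff' hn] at hdep
  push Not at hdep
  exact hdep.imp fun _ hc => hc.symm

/-- If the span of the eigenvectors of `M` is a plane, it is spanned by two eigenvectors. -/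
theorem exists_eigenvectors_span_pair_eq {M : Matrix (Fin 3) (Fin 3) ℂ}
    (hrk : Module.finrank ℂ (eigSpan M) = 2) :
    ∃ u v : C3, (u ≠ 0 ∧ ∃ μ : ℂ, M.mulVec u = μ • u) ∧
      (v ≠ 0 ∧ ∃ μ : ℂ, M.mulVec v = μ • v) ∧
      LinearIndependent ℂ ![u, v] ∧ Submodule.span ℂ {u, v} = eigSpan M := by
  have h := Submodule.exists_fun_fin_finrank_span_eq ℂ
    {z : C3 | z ≠ 0 ∧ ∃ μ : ℂ, M.mulVec z = μ • z}
  rw [← eigSpan, hrk] at h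
  obtain ⟨f, hf, hspan, hli⟩ := h
  have hfe : f = ![f 0, f 1] := by
    ext i : 1
    fin_cases i <;> rfl
  refine ⟨f 0, f 1, hf 0, hf 1, hfe ▸ hli, ?_⟩
  rw [← hspan, hfe, Matrix.range_cons_cons_empty]
  rfl

/-- The normal of a plane spanned by two eigenvectors of a symmetric matrix is an eigenvector. -/
theorem mulVec_cross_eq_smul {M : Matrix (Fin 3) (Fin 3) ℂ} (hM : Mᵀ = M) {u v : C3} {α β : ℂ}
    (hu : M.mulVec u = α • u) (hv : M.mulVec v = β • v) (hn : u ⨯₃ v ≠ 0) :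
    ∃ c : ℂ, M.mulVec (u ⨯₃ v) = c • (u ⨯₃ v) := by
  have hadj (x y : C3) : x ⬝ᵥ M.mulVec y = M.mulVec x ⬝ᵥ y := by
    rw [dotProduct_mulVec, ← mulVec_transpose, hM]
  apply exists_eq_smul_of_cross_eq_zero hn
  have h₁ : u ⬝ᵥ M.mulVec (u ⨯₃ v) = 0 := by
    rw [hadj, hu, smul_dotProduct, dot_self_cross, smul_zero]
  have h₂ : v ⬝ᵥ M.mulVec (u ⨯₃ v) = 0 := by
    rw [hadj, hv, smul_dotProduct, dot_cross_self, smul_zero]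
  rw [cross_cross_eq_smul_sub_smul, h₁, h₂, zero_smul, zero_smul, sub_zero]

/-- A plane in `ℂ³` with isotropic normal is not spanned by two isotropic vectors. -/
theorem not_isotropic_of_linearIndependent {u v : C3} (hli : LinearIndependent ℂ ![u, v])
    (hnn : (u ⨯₃ v) ⬝ᵥ (u ⨯₃ v) = 0) : u ⬝ᵥ u ≠ 0 ∨ v ⬝ᵥ v ≠ 0 := by
  by_contra! h
  obtain ⟨hu, hv⟩ := h
  have hn : u ⨯₃ v ≠ 0 := crossProduct_ne_zero_iff_linearIndependent.mpr hli
  have huv : u ⬝ᵥ v = 0 := by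
    rw [cross_dot_cross, hu, hv, dotProduct_comm v u] at hnn
    simpa using hnn
  obtain ⟨c, hc⟩ := exists_eq_smul_of_cross_eq_zero hn (w := u) (by
    rw [cross_cross_eq_smul_sub_smul, hu, dotProduct_comm v u, huv]; simp)
  obtain ⟨d, hd⟩ := exists_eq_smul_of_cross_eq_zero hn (w := v) (by
    rw [cross_cross_eq_smul_sub_smul, hv, huv]; simp)
  apply hn
  calc u ⨯₃ v = (c • u ⨯₃ v) ⨯₃ (d • u ⨯₃ v) := congrArg₂ (fun x y => x ⨯₃ y) hc hd
    _ = 0 := by rw [LinearMap.map_smul₂, map_smul, cross_self, smul_zero, smul_zero]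

/-- A non-isotropic eigenvector can be rescaled to a unit one. -/
theorem exists_unit_eigenvector {M : Matrix (Fin 3) (Fin 3) ℂ} {n z : C3}
    (hz : z ≠ 0 ∧ ∃ μ : ℂ, M.mulVec z = μ • z) (hnz : n ⬝ᵥ z = 0) (hzz : z ⬝ᵥ z ≠ 0) :
    ∃ ζ : C3, (ζ ≠ 0 ∧ ∃ μ : ℂ, M.mulVec ζ = μ • ζ) ∧ b ζ ζ = 1 ∧ b n ζ = 0 := by
  obtain ⟨hz0, μ, hμ⟩ := hz
  obtain ⟨s, hs⟩ := IsAlgClosed.exists_pow_nat_eq (z ⬝ᵥ z) two_pos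
  have hs0 : s ≠ 0 := by
    rintro rfl
    exact hzz (by simpa using hs.symm)
  refine ⟨s⁻¹ • z, ⟨smul_ne_zero (inv_ne_zero hs0) hz0, μ, ?_⟩, ?_, ?_⟩
  · rw [mulVec_smul, hμ, smul_comm]
  · rw [b_eq_dotProduct, smul_dotProduct, dotProduct_smul, ← hs, smul_eq_mul, smul_eq_mul]
    field_simp
  · rw [b_eq_dotProduct, dotProduct_smul, hnz, smul_zero]

/-- Type II/N case of Proposition `thm:JordanPcoo`: if `M` is
complex symmetric and the sum of its eigenspaces is 2-dimensional, then there are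
eigenvectors `ζ₁, ζ₂` with `b(ζ₁,ζ₁) = 0`, `b(ζ₂,ζ₂) = 1`, `b(ζ₁,ζ₂) = 0`. -/
theorem stmt16 (M : Matrix (Fin 3) (Fin 3) ℂ) (hM : Mᵀ = M)
    (hrk : Module.finrank ℂ (eigSpan M) = 2) :
    ∃ ζ₁ ζ₂ : C3,
      (ζ₁ ≠ 0 ∧ ∃ μ : ℂ, M.mulVec ζ₁ = μ • ζ₁) ∧
      (ζ₂ ≠ 0 ∧ ∃ μ : ℂ, M.mulVec ζ₂ = μ • ζ₂) ∧
      b ζ₁ ζ₁ = 0 ∧ b ζ₂ ζ₂ = 1 ∧ b ζ₁ ζ₂ = 0 := by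
  obtain ⟨u, v, hu, hv, hli, hspan⟩ := exists_eigenvectors_span_pair_eq hrk
  obtain ⟨α, hα⟩ := hu.2
  obtain ⟨β, hβ⟩ := hv.2
  have hn : u ⨯₃ v ≠ 0 := crossProduct_ne_zero_iff_linearIndependent.mpr hli
  have heig : u ⨯₃ v ≠ 0 ∧ ∃ μ : ℂ, M.mulVec (u ⨯₃ v) = μ • (u ⨯₃ v) :=
    ⟨hn, mulVec_cross_eq_smul hM hα hβ hn⟩
  have hnu : (u ⨯₃ v) ⬝ᵥ u = 0 := by rw [dotProduct_comm, dot_self_cross]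
  have hnv : (u ⨯₃ v) ⬝ᵥ v = 0 := by rw [dotProduct_comm, dot_cross_self]
  have hmem : u ⨯₃ v ∈ Submodule.span ℂ {u, v} := hspan ▸ Submodule.subset_span heig
  have hnn : (u ⨯₃ v) ⬝ᵥ (u ⨯₃ v) = 0 := by
    obtain ⟨x, y, hxy⟩ := Submodule.mem_span_pair.mp hmem
    nth_rw 2 [← hxy]
    rw [dotProduct_add, dotProduct_smul, dotProduct_smul, hnu, hnv, smul_zero, smul_zero,
      add_zero]
  obtain ⟨ζ, hζ, hζζ, hnζ⟩ : ∃ ζ : C3, (ζ ≠ 0 ∧ ∃ μ : ℂ, M.mulVec ζ = μ • ζ) ∧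
      b ζ ζ = 1 ∧ b (u ⨯₃ v) ζ = 0 := by
    rcases not_isotropic_of_linearIndependent hli hnn with h | h
    · exact exists_unit_eigenvector hu hnu h
    · exact exists_unit_eigenvector hv hnv h
  exact ⟨u ⨯₃ v, ζ, heig, hζ, by rw [b_eq_dotProduct, hnn], hζζ, hnζ⟩
end
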